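/- Let W be a symmetric B-DMC and let G be an invertible upper triangular ℓ×ℓ matrix over GF(2) (so all diagonal entries equal 1). Then for every i ∈ {1,…,ℓ}, the split channel W^{(i)} defined from W and G satisfies I(W^{(i)}) = I(W) and Z(W^{(i)}) = Z(W). -/

import Mathlib

open scoped BigOperators

/-- A binary-input DMC with finite output alphabet `Y`. -/
def IsBDMC {Y : Type} [Fintype Y] (W : ZMod 2 → Y → ℝ) : Prop :=
  (∀ x y, 0 ≤ W x y) ∧ ∀ x, ∑ y, W x y = 1

/-- Symmetry of a B-DMC. -/
def IsSymmetricBDMC {Y : Type} [Fintype Y] (W : ZMod 2 → Y → ℝ) : Prop :=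
  ∃ π : Y → Y, Function.Involutive π ∧ ∀ y, W 1 y = W 0 (π y)

/-- Symmetric mutual information `I(W)` (base-2 logarithm). -/
noncomputable def mutualInfo {Y : Type} [Fintype Y] (W : ZMod 2 → Y → ℝ) : ℝ :=
  ∑ y, ∑ x : ZMod 2,
    (1 / 2) * W x y * Real.logb 2 (W x y / ((1 / 2) * W 0 y + (1 / 2) * W 1 y))

/-- Bhattacharyya parameter `Z(W)`. -/
noncomputable def bhatt {Y : Type} [Fintype Y] (W : ZMod 2 → Y → ℝ) : ℝ :=
  ∑ y, Real.sqrt (W 0 y * W 1 y)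

/-- The split channel `W^{(i)}` (here `i : Fin m` is 0-based). -/
noncomputable def splitChannel {Y : Type} [Fintype Y] {m : ℕ}
    (W : ZMod 2 → Y → ℝ) (G : Matrix (Fin m) (Fin m) (ZMod 2)) (i : Fin m) :
    ZMod 2 → ((Fin m → Y) × (Fin i.val → ZMod 2)) → ℝ :=
  fun ui z =>
    (1 / 2 ^ (m - 1)) *
      ∑ u ∈ Finset.univ.filter
          (fun u : Fin m → ZMod 2 =>
            u i = ui ∧ ∀ j : Fin i.val, u (Fin.castLE i.isLt.le j) = z.2 j),
        ∏ j, W (Matrix.vecMul u G j) (z.1 j)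

/-- The channel `W^k` (k independent uses of `W` with the same input). -/
noncomputable def prodChannel {Y : Type} [Fintype Y] (W : ZMod 2 → Y → ℝ) (k : ℕ) :
    ZMod 2 → (Fin k → Y) → ℝ :=
  fun x y => ∏ j, W x (y j)

def IsUpperTriangular {l : ℕ} (M : Matrix (Fin l) (Fin l) (ZMod 2)) : Prop :=
  ∀ i j : Fin l, j < i → M i j = 0

/-- `G` is polarizing: invertible and no column permutation is upper triangular. -/
def IsPolarizing {l : ℕ} (G : Matrix (Fin l) (Fin l) (ZMod 2)) : Prop :=
  IsUnit G.det ∧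
    ∀ σ : Equiv.Perm (Fin l), ¬ IsUpperTriangular (Matrix.of fun i j => G i (σ j))

/-- `n`-th Kronecker power of `G`, as an `ℓ^n × ℓ^n` matrix. -/
def kronPow {l : ℕ} (G : Matrix (Fin l) (Fin l) (ZMod 2)) :
    (n : ℕ) → Matrix (Fin (l ^ n)) (Fin (l ^ n)) (ZMod 2)
  | 0 => 1
  | n + 1 =>
      Matrix.reindex (finProdFinEquiv.trans (finCongr (pow_succ' l n).symm))
        (finProdFinEquiv.trans (finCongr (pow_succ' l n).symm))
        (Matrix.kroneckerMap (· * ·) G (kronPow G n))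

theorem IsUpperTriangular.diag_eq_one {l : ℕ} {G : Matrix (Fin l) (Fin l) (ZMod 2)}
    (hG : IsUpperTriangular G) (hGinv : IsUnit G.det) (k : Fin l) : G k k = 1 := by
  have hdet : G.det = ∏ j, G j j := Matrix.det_of_isUpperTriangular fun a b h => hG a b h
  rw [hdet] at hGinv
  have hk : G k k ≠ 0 := Finset.prod_ne_zero_iff.1 hGinv.ne_zero k (Finset.mem_univ k)
  generalize G k k = a at hk
  revert a
  decide

/-- For an upper triangular `G`, entry `k` of `d G` is `d k` when `d` vanishes below `k`. -/
theorem IsUpperTriangular.vecMul_apply_of_forall_lt {l : ℕ}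
    {G : Matrix (Fin l) (Fin l) (ZMod 2)} (hG : IsUpperTriangular G) (hGinv : IsUnit G.det)
    {d : Fin l → ZMod 2} {k : Fin l} (hd : ∀ j < k, d j = 0) : Matrix.vecMul d G k = d k := by
  have hsum : Matrix.vecMul d G k = ∑ j, d j * G j k := rfl
  rw [hsum, Finset.sum_eq_single k, hG.diag_eq_one hGinv, mul_one]
  · intro j _ hj
    rcases lt_or_gt_of_ne hj with h | h
    · rw [hd j h, zero_mul]
    · rw [hG j k h, mul_zero]
  · simp

/-- Multiplication by an invertible upper triangular `G` preserves and reflects agreement of the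
initial segments of two vectors. -/
theorem IsUpperTriangular.vecMul_eq_on_initial_iff {l : ℕ}
    {G : Matrix (Fin l) (Fin l) (ZMod 2)} (hG : IsUpperTriangular G) (hGinv : IsUnit G.det)
    (u w : Fin l → ZMod 2) (i : Fin l) :
    (∀ k ≤ i, Matrix.vecMul u G k = Matrix.vecMul w G k) ↔ ∀ k ≤ i, u k = w k := by
  have hsub (k : Fin l) :
      Matrix.vecMul (u - w) G k = Matrix.vecMul u G k - Matrix.vecMul w G k := by
    rw [Matrix.sub_vecMul, Pi.sub_apply]
  constructor
  · intro h k
    induction k using WellFoundedLT.induction with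
    | ind k ih =>
      intro hk
      have h0 := hG.vecMul_apply_of_forall_lt hGinv (d := u - w) (k := k)
        fun j hj => sub_eq_zero.2 (ih j hj (hj.le.trans hk))
      rw [hsub, h k hk, sub_self] at h0
      exact sub_eq_zero.1 h0.symm
  · intro h k hk
    have h0 := hG.vecMul_apply_of_forall_lt hGinv (d := u - w) (k := k)
      fun j hj => sub_eq_zero.2 (h j (hj.le.trans hk))
    rw [hsub, Pi.sub_apply, h k hk, sub_self] at h0
    exact sub_eq_zero.1 h0

/-- The vector with prefix `v` before position `i` and zeros from `i` on. -/
def extendPrefix {l : ℕ} (i : Fin l) (v : Fin i.val → ZMod 2) : Fin l → ZMod 2 :=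
  fun k => if h : k < i then v ⟨k, h⟩ else 0

/-- The factor contributed by coordinate `j ≠ i` to the split channel at `i`, given the prefix `v`,
when the kernel is upper triangular. -/
noncomputable def sideFactor {Y : Type} {l : ℕ} (W : ZMod 2 → Y → ℝ)
    (G : Matrix (Fin l) (Fin l) (ZMod 2)) (i : Fin l) (v : Fin i.val → ZMod 2) (j : Fin l)
    (y : Y) : ℝ :=
  if j < i then W (Matrix.vecMul (extendPrefix i v) G j) y else W 0 y + W 1 y

theorem sum_sideFactor {Y : Type} [Fintype Y] {l : ℕ} {W : ZMod 2 → Y → ℝ} (hW : IsBDMC W)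
    (G : Matrix (Fin l) (Fin l) (ZMod 2)) (i : Fin l) (v : Fin i.val → ZMod 2) (j : Fin l) :
    ∑ y, sideFactor W G i v j y = if j < i then 1 else 2 := by
  unfold sideFactor
  split_ifs
  · exact hW.2 _
  · rw [Finset.sum_add_distrib, hW.2, hW.2]
    norm_num

theorem sideFactor_nonneg {Y : Type} [Fintype Y] {l : ℕ} {W : ZMod 2 → Y → ℝ} (hW : IsBDMC W)
    (G : Matrix (Fin l) (Fin l) (ZMod 2)) (i : Fin l) (v : Fin i.val → ZMod 2) (j : Fin l)
    (y : Y) : 0 ≤ sideFactor W G i v j y := by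
  unfold sideFactor
  split_ifs
  · exact hW.1 _ _
  · exact add_nonneg (hW.1 _ _) (hW.1 _ _)

theorem splitChannel_apply_of_upperTriangular {Y : Type} [Fintype Y] {l : ℕ}
    (W : ZMod 2 → Y → ℝ) {G : Matrix (Fin l) (Fin l) (ZMod 2)} (hGinv : IsUnit G.det)
    (hG : IsUpperTriangular G) (i : Fin l) (a : ZMod 2) (y : Fin l → Y)
    (v : Fin i.val → ZMod 2) :
    splitChannel W G i a (y, v) =
      (1 / 2 ^ (l - 1) * ∏ j ∈ Finset.univ.erase i, sideFactor W G i v j (y j)) *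
        W (Matrix.vecMul (extendPrefix i v) G i + a) (y i) := by
  set w : Fin l → ZMod 2 := extendPrefix i v + Pi.single i a with hw
  have hw_lt (k : Fin l) (hk : k < i) : w k = v ⟨k, hk⟩ := by
    simp [hw, extendPrefix, hk, hk.ne]
  have hw_self : w i = a := by simp [hw, extendPrefix]
  have hwG_lt (k : Fin l) (hk : k < i) :
      Matrix.vecMul w G k = Matrix.vecMul (extendPrefix i v) G k := by
    refine (hG.vecMul_eq_on_initial_iff hGinv _ _ k).2 (fun j hj => ?_) k le_rfl
    simp [hw, (hj.trans_lt hk).ne]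
  have hwG_self :
      Matrix.vecMul w G i = Matrix.vecMul (extendPrefix i v) G i + a := by
    rw [hw, Matrix.add_vecMul, Pi.add_apply,
      hG.vecMul_apply_of_forall_lt hGinv (d := Pi.single i a)
        fun j hj => by simp [hj.ne]]
    simp
  have hmem (u : Fin l → ZMod 2) :
      (u i = a ∧ ∀ j : Fin i.val, u (Fin.castLE i.isLt.le j) = v j) ↔
        ∀ k ≤ i, Matrix.vecMul u G k = Matrix.vecMul w G k := by
    rw [hG.vecMul_eq_on_initial_iff hGinv]
    constructor
    · rintro ⟨h1, h2⟩ k hk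
      rcases hk.eq_or_lt with rfl | hk
      · rw [h1, hw_self]
      · rw [hw_lt k hk]
        exact h2 ⟨k, hk⟩
    · intro h
      refine ⟨(h i le_rfl).trans hw_self, fun j => ?_⟩
      have hj : Fin.castLE i.isLt.le j < i := j.isLt
      exact (h _ hj.le).trans (hw_lt _ hj)
  let t : Fin l → Finset (ZMod 2) :=
    fun j => if j ≤ i then {Matrix.vecMul w G j} else Finset.univ
  have hmem_t (x : Fin l → ZMod 2) :
      x ∈ Fintype.piFinset t ↔ ∀ k ≤ i, x k = Matrix.vecMul w G k := by
    rw [Fintype.mem_piFinset]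
    refine forall_congr' fun k => ?_
    by_cases hk : k ≤ i <;> simp [t, hk]
  have hsum :
      ∑ u ∈ Finset.univ.filter (fun u : Fin l → ZMod 2 =>
          u i = a ∧ ∀ j : Fin i.val, u (Fin.castLE i.isLt.le j) = v j),
        ∏ j, W (Matrix.vecMul u G j) (y j) =
      ∑ x ∈ Fintype.piFinset t, ∏ j, W (x j) (y j) := by
    refine Finset.sum_nbij' (fun u => Matrix.vecMul u G) (fun x => Matrix.vecMul x G⁻¹)
      ?_ ?_ ?_ ?_ ?_
    · intro u hu
      rw [hmem_t]
      exact (hmem u).1 (Finset.mem_filter.1 hu).2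
    · intro x hx
      rw [hmem_t] at hx
      refine Finset.mem_filter.2 ⟨Finset.mem_univ _, (hmem _).2 ?_⟩
      rwa [Matrix.vecMul_vecMul, Matrix.nonsing_inv_mul G hGinv, Matrix.vecMul_one]
    · intro u _
      simp only [Matrix.vecMul_vecMul, Matrix.mul_nonsing_inv G hGinv, Matrix.vecMul_one]
    · intro x _
      simp only [Matrix.vecMul_vecMul, Matrix.nonsing_inv_mul G hGinv, Matrix.vecMul_one]
    · intro u _
      rfl
  have hside (j : Fin l) (hj : j ∈ Finset.univ.erase i) :
      ∑ x ∈ t j, W x (y j) = sideFactor W G i v j (y j) := by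
    have hne : j ≠ i := Finset.ne_of_mem_erase hj
    rcases lt_or_gt_of_ne hne with h | h
    · simp [t, sideFactor, h, h.le, hwG_lt j h]
    · simp only [t, sideFactor, h.not_gt, h.not_ge, if_false]
      exact Fin.sum_univ_two _
  have hself : ∑ x ∈ t i, W x (y i) = W (Matrix.vecMul (extendPrefix i v) G i + a) (y i) := by
    simp [t, hwG_self]
  simp only [splitChannel]
  rw [hsum, ← Finset.prod_univ_sum t fun j x => W x (y j),
    ← Finset.prod_erase_mul _ _ (Finset.mem_univ i), hself, Finset.prod_congr rfl hside, mul_assoc]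

/-- Every functional `∑ y, φ (W 0 y) (W 1 y)` with `φ` symmetric and positively homogeneous takes
the same value on `W` and on its split channels for an invertible upper triangular kernel. -/
theorem sum_splitChannel_of_upperTriangular {Y : Type} [Fintype Y] {l : ℕ}
    {W : ZMod 2 → Y → ℝ} (hW : IsBDMC W) {G : Matrix (Fin l) (Fin l) (ZMod 2)}
    (hGinv : IsUnit G.det) (hG : IsUpperTriangular G) (i : Fin l) (φ : ℝ → ℝ → ℝ)
    (hsymm : ∀ a b, φ a b = φ b a) (hhom : ∀ c a b, 0 ≤ c → φ (c * a) (c * b) = c * φ a b) :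
    ∑ z, φ (splitChannel W G i 0 z) (splitChannel W G i 1 z) = ∑ y, φ (W 0 y) (W 1 y) := by
  have hpoint (y : Fin l → Y) (v : Fin i.val → ZMod 2) :
      φ (splitChannel W G i 0 (y, v)) (splitChannel W G i 1 (y, v)) =
        1 / 2 ^ (l - 1) *
          ∏ j, if j = i then φ (W 0 (y j)) (W 1 (y j)) else sideFactor W G i v j (y j) := by
    rw [splitChannel_apply_of_upperTriangular W hGinv hG,
      splitChannel_apply_of_upperTriangular W hGinv hG, hhom _ _ _ (mul_nonneg (by positivity)
        (Finset.prod_nonneg fun j _ => sideFactor_nonneg hW G i v j _)),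
      ← Finset.prod_erase_mul _ _ (Finset.mem_univ i), if_pos rfl, mul_assoc]
    have hprod : ∏ j ∈ Finset.univ.erase i,
        (if j = i then φ (W 0 (y j)) (W 1 (y j)) else sideFactor W G i v j (y j)) =
        ∏ j ∈ Finset.univ.erase i, sideFactor W G i v j (y j) :=
      Finset.prod_congr rfl fun j hj => if_neg (Finset.ne_of_mem_erase hj)
    have hflip (c : ZMod 2) :
        φ (W (c + 0) (y i)) (W (c + 1) (y i)) = φ (W 0 (y i)) (W 1 (y i)) := by
      have hc : c = 0 ∨ c = 1 := by revert c; decide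
      rcases hc with rfl | rfl
      · simp
      · have h2 : (1 + 1 : ZMod 2) = 0 := rfl
        rw [h2, add_zero, hsymm]
    rw [hprod, hflip]
  have hcount : ∏ j ∈ Finset.univ.erase i, (if j < i then (1 : ℝ) else 2) = 2 ^ (l - 1 - i) := by
    rw [Finset.prod_ite, Finset.prod_const_one, one_mul, Finset.prod_const, ← Fin.card_Ioi]
    congr 2
    ext j
    simp only [Finset.mem_filter, Finset.mem_erase, Finset.mem_univ, Finset.mem_Ioi, and_true,
      not_lt]
    exact ⟨fun h => lt_of_le_of_ne h.2 h.1.symm, fun h => ⟨h.ne', h.le⟩⟩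
  have hinner (v : Fin i.val → ZMod 2) :
      ∑ y : Fin l → Y, φ (splitChannel W G i 0 (y, v)) (splitChannel W G i 1 (y, v)) =
        1 / 2 ^ (l - 1) * (2 ^ (l - 1 - i) * ∑ y, φ (W 0 y) (W 1 y)) := by
    simp_rw [hpoint]
    rw [← Finset.mul_sum, ← Fintype.prod_sum fun j y =>
        if j = i then φ (W 0 y) (W 1 y) else sideFactor W G i v j y,
      ← Finset.prod_erase_mul _ _ (Finset.mem_univ i), ← hcount]
    congr 2
    · refine Finset.prod_congr rfl fun j hj => ?_
      simp only [if_neg (Finset.ne_of_mem_erase hj)]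
      exact sum_sideFactor hW G i v j
    · simp
  have hpow : (2 : ℝ) ^ (i : ℕ) * 2 ^ (l - 1 - i) = 2 ^ (l - 1) := by
    rw [← pow_add]
    congr 1
    omega
  rw [Fintype.sum_prod_type_right]
  simp_rw [hinner]
  rw [Finset.sum_const, Finset.card_univ, Fintype.card_fun, Fintype.card_fin, ZMod.card,
    nsmul_eq_mul, ← hpow]
  push_cast
  field_simp

/-- If `G` is invertible and upper triangular, then every split channel is
equivalent to `W`: it has the same symmetric mutual information and Bhattacharyya parameter. -/
theorem splitChannel_eq_of_upperTriangular {Y : Type} [Fintype Y] {l : ℕ}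
    (W : ZMod 2 → Y → ℝ) (hW : IsBDMC W) (hsym : IsSymmetricBDMC W)
    (G : Matrix (Fin l) (Fin l) (ZMod 2)) (hGinv : IsUnit G.det)
    (hG : IsUpperTriangular G) (i : Fin l) :
    mutualInfo (splitChannel W G i) = mutualInfo W ∧
      bhatt (splitChannel W G i) = bhatt W := by
  constructor
  · have h := sum_splitChannel_of_upperTriangular hW hGinv hG i
      (fun a b => 1 / 2 * a * Real.logb 2 (a / (1 / 2 * a + 1 / 2 * b)) +
        1 / 2 * b * Real.logb 2 (b / (1 / 2 * a + 1 / 2 * b)))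
      (fun a b => by rw [add_comm (1 / 2 * a) (1 / 2 * b), add_comm]) ?_
    · simp only [mutualInfo]
      refine (Finset.sum_congr rfl fun z _ => ?_).trans
        (h.trans (Finset.sum_congr rfl fun y _ => ?_))
      · exact Fin.sum_univ_two fun x : ZMod 2 => 1 / 2 * splitChannel W G i x z *
          Real.logb 2 (splitChannel W G i x z /
            (1 / 2 * splitChannel W G i 0 z + 1 / 2 * splitChannel W G i 1 z))
      · exact (Fin.sum_univ_two fun x : ZMod 2 => 1 / 2 * W x y *
          Real.logb 2 (W x y / (1 / 2 * W 0 y + 1 / 2 * W 1 y))).symm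
    · intro c a b hc
      rcases hc.eq_or_lt with rfl | hc
      · simp
      · have hden : 1 / 2 * (c * a) + 1 / 2 * (c * b) = c * (1 / 2 * a + 1 / 2 * b) := by ring
        simp only [hden, mul_div_mul_left _ _ hc.ne']
        ring
  · refine sum_splitChannel_of_upperTriangular hW hGinv hG i (fun a b => Real.sqrt (a * b))
      (fun a b => by rw [mul_comm]) fun c a b hc => ?_
    rw [mul_mul_mul_comm, Real.sqrt_mul (mul_self_nonneg c), Real.sqrt_mul_self hc]
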